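/- arXiv:0706.2032 — 3 statements merged into one kernel-verified Lean document; each statement's English description precedes it below -/
import Mathlib

section
/- Let R be a commutative ring, let n and m be natural numbers with m ≤ n, and let a, b : Matrix (Fin n) (Fin n) R be matrices such that b i j = 0 whenever i.val ≥ m or j.val ≥ m (i.e., the entries b i j can be nonzero only in the top-left m × m block). Define the matrix C over the polynomial ring R[q] by C i j = (constant polynomial a i j) + (constant polynomial b i j) * q. Then the determinant det C ∈ R[q] has natDegree at most m, and the coefficient of q^0 in det C equals det a. -/
open Polynomial

/-- The degree of the determinant of a polynomial matrix is at most the sum of degree bounds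
for its columns. -/
theorem Matrix.natDegree_det_le_sum_of_col {R ι : Type*} [CommRing R] [Fintype ι] [DecidableEq ι]
    (M : Matrix ι ι R[X]) (d : ι → ℕ) (hd : ∀ i j, (M i j).natDegree ≤ d j) :
    M.det.natDegree ≤ ∑ j, d j := by
  rw [Matrix.det_apply]
  refine natDegree_sum_le_of_forall_le _ _ fun σ _ => ?_
  refine (natDegree_smul_le _ _).trans ((natDegree_prod_le _ _).trans ?_)
  exact Finset.sum_le_sum fun j _ => hd (σ j) j

/-- The determinant computation of Section 3.3: if the entries of `b` vanish outside the
top-left `m × m` block, then the determinant of the matrix `C` with entries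
`C (a i j) + C (b i j) * X` over `R[q]` has degree at most `m`, and its constant
coefficient is `det a`. -/
theorem det_matrix_linear_natDegree_le_and_coeff_zero
    {R : Type*} [CommRing R] (n m : ℕ) (hm : m ≤ n)
    (a b : Matrix (Fin n) (Fin n) R)
    (hb : ∀ i j : Fin n, m ≤ i.val ∨ m ≤ j.val → b i j = 0) :
    (Matrix.det (Matrix.of fun i j : Fin n =>
        (Polynomial.C (a i j) + Polynomial.C (b i j) * Polynomial.X))).natDegree ≤ m ∧
    (Matrix.det (Matrix.of fun i j : Fin n =>
        (Polynomial.C (a i j) + Polynomial.C (b i j) * Polynomial.X))).coeff 0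
      = Matrix.det a := by
  refine ⟨?_, ?_⟩
  · refine (Matrix.natDegree_det_le_sum_of_col _ (fun j => if j.val < m then 1 else 0)
      fun i j => ?_).trans ?_
    · rw [Matrix.of_apply]
      split_ifs with hj
      · compute_degree
      · simp [hb i j (Or.inr (not_lt.mp hj))]
    · rw [← Finset.card_filter, Fin.card_filter_val_lt]
      exact min_le_right n m
  · rw [coeff_zero_eq_eval_zero, ← coe_evalRingHom, RingHom.map_det]
    congr 1
    ext i j
    simp
end

section
/- Let n and m be natural numbers with m ≤ n, and let a, b : Matrix (Fin n) (Fin n) ℤ be integer matrices such that b i j = 0 whenever i.val ≥ m or j.val ≥ m. Define the matrix C over ℤ[q] by C i j = (constant polynomial a i j) + (constant polynomial b i j) * q, and set D = det C ∈ ℤ[q]. Suppose D ≠ 0, that natDegree D − natTrailingDegree D = m, and that the trailing coefficient of D (the coefficient of its lowest-degree nonzero term) is 1 or −1. Then det a = 1 or det a = −1. -/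
open Polynomial

/-- A polynomial matrix of degree at most one whose rows from `m` on are constant has
determinant of degree at most `m`. -/
theorem natDegree_det_C_add_C_mul_X_le_of_rows_eq_zero {R : Type*} [CommRing R] {n m : ℕ}
    (hm : m ≤ n) (a b : Matrix (Fin n) (Fin n) R)
    (hb : ∀ i j : Fin n, m ≤ i.val → b i j = 0) :
    (Matrix.det (Matrix.of fun i j : Fin n => C (a i j) + C (b i j) * X)).natDegree ≤ m := by
  rw [← Matrix.det_transpose, Matrix.det_apply]
  refine natDegree_sum_le_of_forall_le _ _ fun σ _ => ?_
  refine (natDegree_smul_le _ _).trans ((natDegree_prod_le _ _).trans ?_)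
  calc ∑ i : Fin n, (C (a i (σ i)) + C (b i (σ i)) * X : R[X]).natDegree
      ≤ ∑ i : Fin n, if i.val < m then 1 else 0 := by
        refine Finset.sum_le_sum fun i _ => ?_
        split_ifs with h
        · compute_degree
        · simp [hb i (σ i) (not_lt.mp h)]
    _ = m := by
        rw [Finset.sum_boole, Fin.card_filter_val_lt, min_eq_right hm, Nat.cast_id]

/-- The constant coefficient of `det (a + b X)` is `det a`. -/
theorem coeff_zero_det_C_add_C_mul_X {R : Type*} [CommRing R] {n : ℕ}
    (a b : Matrix (Fin n) (Fin n) R) :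
    (Matrix.det (Matrix.of fun i j : Fin n => C (a i j) + C (b i j) * X)).coeff 0 = a.det := by
  rw [← constantCoeff_apply, RingHom.map_det]
  congr 1
  ext i j
  simp

/-- Equation (5) of the paper: if the entries of `b` vanish outside the top-left `m × m`
block, `D = det (C (a i j) + C (b i j) * X)` is nonzero, its degree span
`natDegree D - natTrailingDegree D` equals `m`, and its trailing coefficient is `±1`,
then `det a = ±1`. -/
theorem det_eq_pm_one_of_trailingCoeff_pm_one
    (n m : ℕ) (hm : m ≤ n)
    (a b : Matrix (Fin n) (Fin n) ℤ)
    (hb : ∀ i j : Fin n, m ≤ i.val ∨ m ≤ j.val → b i j = 0)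
    (D : Polynomial ℤ)
    (hD : D = Matrix.det (Matrix.of fun i j : Fin n =>
        (Polynomial.C (a i j) + Polynomial.C (b i j) * Polynomial.X)))
    (hD0 : D ≠ 0)
    (hspan : D.natDegree - D.natTrailingDegree = m)
    (htc : D.coeff D.natTrailingDegree = 1 ∨ D.coeff D.natTrailingDegree = -1) :
    Matrix.det a = 1 ∨ Matrix.det a = -1 := by
  have hdeg : D.natDegree ≤ m := by
    rw [hD]
    exact natDegree_det_C_add_C_mul_X_le_of_rows_eq_zero hm a b fun i j h => hb i j (Or.inl h)
  have hle : D.natTrailingDegree ≤ D.natDegree := natTrailingDegree_le_natDegree D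
  have hcoeff : D.coeff 0 = a.det := by
    rw [hD]
    exact coeff_zero_det_C_add_C_mul_X a b
  have htrail : D.natTrailingDegree = 0 := by omega
  rwa [htrail, hcoeff] at htc
end

section
/- Let n be a positive natural number and write ℤ^n for the additive group Fin n → ℤ. Let A and B be (additive) abelian groups, let i : ℤ^n → A × B be an injective group homomorphism, and let p : A × B → ℤ^n be a surjective group homomorphism whose kernel equals the range of i (so 0 → ℤ^n → A × B → ℤ^n → 0 is a short exact sequence). Suppose that the composite maps p ∘ inl : A → ℤ^n and p ∘ inr : B → ℤ^n (where inl a = (a,0) and inr b = (0,b)) are both surjective. Then p ∘ inl and p ∘ inr are both bijective; in particular, A and B are each isomorphic to the free abelian group ℤ^n. -/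
/-- If a finitely generated abelian group `G` surjects onto `H`, then every surjective homomorphism
from `H` onto `G` is bijective. -/
theorem AddMonoidHom.bijective_of_surjective_of_surjective {G H : Type*} [AddCommGroup G]
    [AddCommGroup H] [Module.Finite ℤ G] {f : G →+ H} {g : H →+ G}
    (hf : Function.Surjective f) (hg : Function.Surjective g) : Function.Bijective g :=
  ⟨Function.Injective.of_comp_right
    (OrzechProperty.injective_of_surjective_endomorphism (g.comp f).toIntLinearMap (hg.comp hf)) hf,
    hg⟩

/-- If `A` surjects onto the codomain of `p : A × B →+ C`, then `p.ker` projects onto `B`. -/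
theorem AddMonoidHom.surjective_snd_comp_of_ker_eq_range {A B C D : Type*} [AddCommGroup A]
    [AddCommGroup B] [AddCommGroup C] [AddCommGroup D] {i : D →+ A × B} {p : A × B →+ C}
    (h : p.ker = i.range) (hA : Function.Surjective (p.comp (AddMonoidHom.inl A B))) :
    Function.Surjective ((AddMonoidHom.snd A B).comp i) := by
  intro b
  obtain ⟨a, ha⟩ := hA (-p (0, b))
  have hab : (a, b) ∈ p.ker := by
    have hsum : p (a, b) = p (a, 0) + p (0, b) := by simp [← map_add]
    rw [AddMonoidHom.mem_ker, hsum]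
    exact eq_neg_iff_add_eq_zero.mp ha
  rw [h] at hab
  obtain ⟨d, hd⟩ := hab
  exact ⟨d, congrArg Prod.snd hd⟩

/-- If `B` surjects onto the codomain of `p : A × B →+ C`, then `p.ker` projects onto `A`. -/
theorem AddMonoidHom.surjective_fst_comp_of_ker_eq_range {A B C D : Type*} [AddCommGroup A]
    [AddCommGroup B] [AddCommGroup C] [AddCommGroup D] {i : D →+ A × B} {p : A × B →+ C}
    (h : p.ker = i.range) (hB : Function.Surjective (p.comp (AddMonoidHom.inr A B))) :
    Function.Surjective ((AddMonoidHom.fst A B).comp i) := by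
  intro a
  obtain ⟨b, hb⟩ := hB (-p (a, 0))
  have hab : (a, b) ∈ p.ker := by
    have hsum : p (a, b) = p (0, b) + p (a, 0) := by simp [← map_add]
    rw [AddMonoidHom.mem_ker, hsum]
    exact eq_neg_iff_add_eq_zero.mp hb
  rw [h] at hab
  obtain ⟨d, hd⟩ := hab
  exact ⟨d, congrArg Prod.fst hd⟩

/-- The homological-algebra core of Lemma 3.2: given a short exact sequence
`0 → ℤ^n → A × B → ℤ^n → 0` of abelian groups such that the composites
`A → A × B → ℤ^n` and `B → A × B → ℤ^n` are both surjective, these composites are in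
fact bijective; in particular `A` and `B` are each isomorphic to `ℤ^n`. -/
theorem bijective_of_short_exact_prod_surjective
    (n : ℕ) (hn : 0 < n)
    (A B : Type*) [AddCommGroup A] [AddCommGroup B]
    (i : (Fin n → ℤ) →+ A × B) (p : (A × B) →+ (Fin n → ℤ))
    (hi : Function.Injective i)
    (hp : Function.Surjective p)
    (hker : p.ker = i.range)
    (hA : Function.Surjective (p.comp (AddMonoidHom.inl A B)))
    (hB : Function.Surjective (p.comp (AddMonoidHom.inr A B))) :
    Function.Bijective (p.comp (AddMonoidHom.inl A B)) ∧
    Function.Bijective (p.comp (AddMonoidHom.inr A B)) ∧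
    Nonempty (A ≃+ (Fin n → ℤ)) ∧ Nonempty (B ≃+ (Fin n → ℤ)) := by
  have bijA := AddMonoidHom.bijective_of_surjective_of_surjective
    (AddMonoidHom.surjective_fst_comp_of_ker_eq_range hker hB) hA
  have bijB := AddMonoidHom.bijective_of_surjective_of_surjective
    (AddMonoidHom.surjective_snd_comp_of_ker_eq_range hker hA) hB
  exact ⟨bijA, bijB, ⟨AddEquiv.ofBijective _ bijA⟩, ⟨AddEquiv.ofBijective _ bijB⟩⟩
end
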